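/- arXiv:1703.01891 — 5 statements merged into one kernel-verified Lean document; each statement's English description precedes it below -/
import Mathlib

section
/- Let λ be the cardinal defined by λ_0 = ℵ₀, λ_{n+1} = 2^{λ_n} and λ = sup_n λ_n. Let Λ be a set of cardinality at least λ, let n ≥ 1 be a natural number, and let σ be a map from the n-element subsets of Λ to an arbitrary set C. Then at least one of the following holds: (1) there is a sequence (F_j)_{j∈ℕ} of pairwise disjoint n-element subsets of Λ such that σ(F_i) = σ(F_j) for all i, j ∈ ℕ; or (2) there is an (n−1)-element subset F of Λ such that the set σ({F ∪ {γ} : γ ∈ Λ \ F}) is infinite. -/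
open Cardinal

/-- The sequence `λ₀ = ℵ₀`, `λ_{n+1} = 2 ^ λ_n`. -/
def lamSeq : ℕ → Cardinal
  | 0 => ℵ₀
  | n + 1 => 2 ^ lamSeq n

/-- The cardinal `λ = sup_n λ_n`. -/
noncomputable def lam : Cardinal := ⨆ n, lamSeq n

/-- A function with finite image on an infinite set has an infinite fiber in that set. -/
theorem Set.Infinite.exists_infinite_fiber_of_finite_image {α β : Type*} {s : Set α}
    (hs : s.Infinite) {f : α → β} (hf : (f '' s).Finite) :
    ∃ b ∈ f '' s, (s ∩ f ⁻¹' {b}).Infinite := by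
  by_contra! h
  refine hs ((hf.biUnion fun b hb => h b hb).subset fun a ha => ?_)
  exact Set.mem_biUnion (Set.mem_image_of_mem f ha) ⟨ha, rfl⟩

theorem aleph0_le_lamSeq (n : ℕ) : ℵ₀ ≤ lamSeq n := by
  induction n with
  | zero => exact le_rfl
  | succ n ih => exact ih.trans (cantor _).le

theorem lamSeq_le_lam (n : ℕ) : lamSeq n ≤ lam :=
  le_ciSup bddAbove_of_small n

/-- If every `n`-element subset of `B` has only finitely many colours among its one-point
extensions in `B`, then some colour is attained on `(n + 1)`-element subsets of `B` avoiding any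
prescribed finite set. -/
theorem exists_color_avoiding_finset {Λ : Type*} [DecidableEq Λ] {C : Type*} (n : ℕ) :
    ∀ (B : Set Λ) (σ : Finset Λ → C), lamSeq n ≤ #B →
      (∀ F : Finset Λ, (F : Set Λ) ⊆ B → F.card = n →
        ((fun γ => σ (insert γ F)) '' (B \ F)).Finite) →
      ∃ c, ∀ S : Finset Λ, ∃ F : Finset Λ,
        (F : Set Λ) ⊆ B ∧ F.card = n + 1 ∧ Disjoint F S ∧ σ F = c := by
  induction n with
  | zero =>
    intro B σ hB hfin
    have hBinf : B.Infinite := Set.infinite_coe_iff.1 (Cardinal.infinite_iff.2 hB)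
    have h := hfin ∅ (by simp) rfl
    simp only [Finset.coe_empty, Set.sdiff_empty] at h
    obtain ⟨c, -, hc⟩ := hBinf.exists_infinite_fiber_of_finite_image h
    refine ⟨c, fun S => ?_⟩
    obtain ⟨a, ⟨haB, hac⟩, haS⟩ := hc.exists_notMem_finset S
    exact ⟨{a}, by simpa using haB, by simp, by simpa using haS, by simpa using hac⟩
  | succ n ih =>
    intro B σ hB hfin
    have hlt : lamSeq n < lamSeq (n + 1) := cantor _
    obtain ⟨A, hAB, hA⟩ := Cardinal.le_mk_iff_exists_subset.1 (hlt.le.trans hB)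
    have hAinf : Infinite A := Cardinal.infinite_iff.2 (hA ▸ aleph0_le_lamSeq n)
    have hdiff : #A < #(B \ A : Set Λ) := by
      by_contra! h
      have hBA : #B ≤ #A := by
        rw [← Set.union_sdiff_cancel hAB]
        exact (mk_union_le _ _).trans
          (add_le_of_le (Cardinal.infinite_iff.1 hAinf) le_rfl h)
      exact absurd (hB.trans hBA) (by rw [hA]; exact hlt.not_ge)
    have hcolor : ∀ a : (B \ A : Set Λ), ∃ c, ∀ S : Finset Λ, ∃ F : Finset Λ,
        (F : Set Λ) ⊆ A ∧ F.card = n + 1 ∧ Disjoint F S ∧ σ (insert a.1 F) = c := by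
      rintro ⟨a, haB, haA⟩
      refine ih A (fun F => σ (insert a F)) hA.ge fun F hF hFc => ?_
      have haF : a ∉ F := fun h => haA (hF h)
      refine (hfin (insert a F) ?_ (by rw [Finset.card_insert_of_notMem haF, hFc])).subset ?_
      · rw [Finset.coe_insert]
        exact Set.insert_subset haB (hF.trans hAB)
      · rintro _ ⟨γ, ⟨hγA, hγF⟩, rfl⟩
        refine ⟨γ, ⟨hAB hγA, ?_⟩, by simp only [Finset.insert_comm]⟩
        rw [Finset.coe_insert]
        rintro (rfl | h)
        exacts [haA hγA, hγF h]
    classical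
    choose c hc using hcolor
    choose F hFA hFc _ hFσ using fun a => hc a ∅
    have hFinsetA : #(Finset A) < #(B \ A : Set Λ) := by rwa [mk_finset_of_infinite]
    obtain ⟨F₀, hF₀⟩ := exists_infinite_fiber' (fun a => (F a).subtype (· ∈ A))
      hFinsetA
    set T := (fun a => (F a).subtype (· ∈ A)) ⁻¹' {F₀}
    have hTF : ∀ a ∈ T, ∀ b ∈ T, F a = F b := by
      intro a ha b hb
      rw [← Finset.subtype_map_of_mem (hFA a), ← Finset.subtype_map_of_mem (hFA b)]
      exact congrArg _ ((show _ = F₀ from ha).trans (show _ = F₀ from hb).symm)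
    have hTinf : T.Infinite := Set.infinite_coe_iff.1 hF₀
    obtain ⟨a₀, ha₀⟩ := hTinf.nonempty
    have himage : (c '' T).Finite := by
      refine (hfin (F a₀) ((hFA a₀).trans hAB) (hFc a₀)).subset ?_
      rintro _ ⟨a, ha, rfl⟩
      exact ⟨a, ⟨a.2.1, fun h => a.2.2 (hFA a₀ h)⟩, by rw [← hFσ a, hTF a ha a₀ ha₀]⟩
    obtain ⟨c₀, -, hc₀⟩ := hTinf.exists_infinite_fiber_of_finite_image himage
    refine ⟨c₀, fun S => ?_⟩
    obtain ⟨a, ⟨-, hac⟩, haS⟩ := hc₀.exists_notMem_finset (S.subtype (· ∈ B \ A))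
    obtain ⟨G, hGA, hGc, hGS, hGσ⟩ := hc a S
    refine ⟨insert a.1 G, ?_, ?_, ?_, hGσ.trans hac⟩
    · rw [Finset.coe_insert]
      exact Set.insert_subset a.2.1 (hGA.trans hAB)
    · rw [Finset.card_insert_of_notMem fun h => a.2.2 (hGA h), hGc]
    · rw [Finset.disjoint_insert_left]
      exact ⟨fun h => haS (Finset.mem_subtype.2 h), hGS⟩

theorem theoremB {Λ : Type*} [DecidableEq Λ] {C : Type*} (hΛ : lam ≤ #Λ) (n : ℕ) (hn : 1 ≤ n)
    (σ : Finset Λ → C) :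
    (∃ F : ℕ → Finset Λ, (∀ j, (F j).card = n) ∧
        (∀ i j, i ≠ j → Disjoint (F i) (F j)) ∧
        (∀ i j, σ (F i) = σ (F j))) ∨
      (∃ F : Finset Λ, F.card = n - 1 ∧
        (σ '' {G | ∃ γ : Λ, γ ∉ F ∧ G = insert γ F}).Infinite) := by
  obtain ⟨n, rfl⟩ := Nat.exists_eq_add_of_le' hn
  by_cases h : ∃ F : Finset Λ, F.card = n + 1 - 1 ∧
      (σ '' {G | ∃ γ : Λ, γ ∉ F ∧ G = insert γ F}).Infinite
  · exact Or.inr h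
  left
  push Not at h
  obtain ⟨c, hc⟩ := exists_color_avoiding_finset n Set.univ σ
    (by rw [mk_univ]; exact (lamSeq_le_lam n).trans hΛ) fun F _ hF => by
      refine (Set.not_infinite.1 (by simpa using h F hF)).subset ?_
      rintro _ ⟨γ, ⟨-, hγ⟩, rfl⟩
      exact ⟨_, ⟨γ, hγ, rfl⟩, rfl⟩
  obtain ⟨f, hf, hdisj⟩ := exists_seq_of_forall_finset_exists'
    (fun F : Finset Λ => F.card = n + 1 ∧ σ F = c) Disjoint fun s _ => by
      obtain ⟨F, -, hF, hFs, hFσ⟩ := hc (s.biUnion id)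
      exact ⟨F, ⟨hF, hFσ⟩, fun G hG => ((Finset.disjoint_biUnion_right _ _ _).1 hFs G hG).symm⟩
  exact ⟨f, fun j => (hf j).1, fun i j hij => hdisj hij, fun i j => (hf i).2.trans (hf j).2.symm⟩
end

section
/- Let n ≥ 1 and let Γ_1, …, Γ_n be sets each of cardinality at least exp_+(ℵ₁, n²), and let σ : Γ_1 × ⋯ × Γ_n → C be any function into an arbitrary set C. Then at least one of the following holds: (1) there is a sequence (a^{(j)})_{j∈ℕ} of elements of the product which are pairwise diagonal (i.e. a^{(j)}(i) ≠ a^{(k)}(i) for all i whenever j ≠ k) with σ(a^{(j)}) = σ(a^{(k)}) for all j, k; or (2) there is a line L in the product (a set of points agreeing with a fixed point in all coordinates except one) such that σ(L) is infinite. -/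
open Cardinal

/-- `exp_+(β, 0) = β`, `exp_+(β, n+1) = (2 ^ (exp_+(β,n))⁺)⁺`, where `⁺` is the
successor cardinal. -/
noncomputable def expPlus (β : Cardinal) : ℕ → Cardinal
  | 0 => β
  | n + 1 => Order.succ (2 ^ Order.succ (expPlus β n))

theorem aleph0_le_expPlus (n : ℕ) : ℵ₀ ≤ expPlus (aleph 1) n := by
  induction n with
  | zero => exact aleph0_le_aleph 1
  | succ n ih =>
    exact ih.trans ((Order.le_succ _).trans ((cantor _).le.trans (Order.le_succ _)))

theorem expPlus_mono (β : Cardinal) : Monotone (expPlus β) :=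
  monotone_nat_of_le_succ fun _ =>
    (Order.le_succ _).trans ((cantor _).le.trans (Order.le_succ _))

theorem mk_setoid_le {P : Type*} {κ : Cardinal} (hκ : ℵ₀ ≤ κ) (hP : #P ≤ κ) :
    #(Setoid P) ≤ 2 ^ κ := by
  have h : Function.Injective fun s : Setoid P => {p : P × P | s p.1 p.2} := by
    intro s t h
    ext a b
    exact Set.ext_iff.1 h (a, b)
  calc #(Setoid P) ≤ #(Set (P × P)) := mk_le_of_injective h
    _ = 2 ^ (#P * #P) := by simp
    _ ≤ 2 ^ κ := power_le_power_left two_ne_zero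
      ((mul_le_mul' hP hP).trans (mul_eq_self hκ).le)

theorem mk_pi_fin_le {n : ℕ} {Γ : Fin n → Type*} {κ : Cardinal} (hκ : ℵ₀ ≤ κ)
    (h : ∀ i, #(Γ i) ≤ κ) : #(∀ i, Γ i) ≤ κ := by
  rw [mk_pi]
  refine (prod_le_prod _ (fun _ => κ) h).trans ?_
  simpa using power_nat_le (n := n) hκ

/-- A function on a product of large sets which takes finitely many values on every line
takes finitely many values on a product of infinite subsets. -/
theorem exists_infinite_box_finite_image {n : ℕ} {Γ : Fin n → Type*} {C : Type*}
    (hΓ : ∀ i, expPlus (aleph 1) n ≤ #(Γ i)) (σ : (∀ i, Γ i) → C)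
    (hσ : ∀ a i, (Set.range fun x => σ (Function.update a i x)).Finite) :
    ∃ A : ∀ i, Set (Γ i), (∀ i, (A i).Infinite) ∧ (σ '' Set.univ.pi A).Finite := by
  induction n with
  | zero => exact ⟨fun _ => Set.univ, fun i => i.elim0, Set.toFinite _⟩
  | succ n ih =>
    have hκ := aleph0_le_expPlus n
    have hsub (i : Fin n) : ∃ D : Set (Γ i.succ), #D = expPlus (aleph 1) n :=
      le_mk_iff_exists_set.1 ((expPlus_mono _ n.le_succ).trans (hΓ i.succ))
    choose D hD using hsub
    let F (z : Γ 0) (y : ∀ i, D i) : C := σ (Fin.cons z fun i => (y i : Γ i.succ))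
    have hcard : #(Setoid (∀ i, D i)) ≤ 2 ^ expPlus (aleph 1) n :=
      mk_setoid_le hκ (mk_pi_fin_le hκ fun i => (hD i).le)
    have hlt : 2 ^ expPlus (aleph 1) n < #(Γ 0) :=
      lt_of_lt_of_le (Order.lt_succ_of_le
        (power_le_power_left two_ne_zero (Order.le_succ _))) (hΓ 0)
    have : Infinite (Γ 0) := infinite_iff.2 ((aleph0_le_expPlus _).trans (hΓ 0))
    obtain ⟨K, hK⟩ := exists_infinite_fiber (fun z => Setoid.ker (F z))
      (hcard.trans_lt hlt)
    rw [Set.infinite_coe_iff] at hK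
    obtain ⟨z₀, hz₀⟩ := hK.nonempty
    obtain ⟨A, hA, hfin⟩ := ih (fun i => (hD i).ge) (F z₀) (by
      intro a i
      refine (hσ (Fin.cons z₀ fun i => (a i : Γ i.succ)) i.succ).subset ?_
      rintro _ ⟨x, rfl⟩
      refine ⟨x, ?_⟩
      simp only [F, ← Fin.cons_update]
      congr 2
      ext j
      rw [Function.apply_update (fun i (y : D i) => (y : Γ i.succ))])
    obtain ⟨T, -, hTbij⟩ := Set.exists_subset_bijOn (Set.univ.pi A) (F z₀)
    have hT : T.Finite := hTbij.finite_iff_finite.2 hfin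
    have hTF := hTbij.image_eq
    refine ⟨Fin.cons ((fun z => Setoid.ker (F z)) ⁻¹' {K}) fun i => (↑) '' A i, ?_, ?_⟩
    · refine Fin.cases hK fun i => ?_
      simpa using (hA i).image Subtype.val_injective.injOn
    · have hcol (y : ∀ i, D i) : (Set.range fun z => F z y).Finite := by
        have := hσ (Fin.cons z₀ fun i => (y i : Γ i.succ)) 0
        simpa only [Fin.update_cons_zero] using this
      refine (hT.biUnion fun y _ => hcol y).subset ?_
      rintro _ ⟨b, hb, rfl⟩
      have hb0 : Setoid.ker (F (b 0)) = K := hb 0 trivial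
      have hbs (i : Fin n) : ∃ x ∈ A i, (x : Γ i.succ) = b i.succ := by
        simpa using hb i.succ trivial
      choose y hyA hy using hbs
      have hyT : F z₀ y ∈ F z₀ '' T := hTF ▸ ⟨y, fun i _ => hyA i, rfl⟩
      obtain ⟨t, htT, ht⟩ := hyT
      have hker : Setoid.ker (F z₀) = Setoid.ker (F (b 0)) := Eq.trans hz₀ hb0.symm
      have hbt : F (b 0) t = F (b 0) y := by
        rw [← Setoid.ker_def, ← hker, Setoid.ker_def, ht]
      refine Set.mem_biUnion htT ⟨b 0, hbt.trans ?_⟩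
      simp only [F, hy]
      exact congrArg σ (Fin.cons_self_tail b)

theorem thm_3_2 {n : ℕ} (hn : 1 ≤ n) {Γ : Fin n → Type*} {C : Type*}
    (hΓ : ∀ i, expPlus (aleph 1) (n ^ 2) ≤ #(Γ i))
    (σ : (∀ i, Γ i) → C) :
    (∃ a : ℕ → ∀ i, Γ i,
        (∀ j k, j ≠ k → ∀ i, a j i ≠ a k i) ∧
        (∀ j k, σ (a j) = σ (a k))) ∨
      (∃ (a : ∀ i, Γ i) (i : Fin n),
        (σ '' {b | ∀ j, j ≠ i → b j = a j}).Infinite) := by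
  refine or_iff_not_imp_right.2 fun hline => ?_
  simp only [not_exists, Set.not_infinite] at hline
  obtain ⟨A, hA, hfin⟩ := exists_infinite_box_finite_image
    (fun i => (expPlus_mono _ (Nat.le_self_pow two_ne_zero n)).trans (hΓ i)) σ (by
      intro a i
      refine (hline a i).subset ?_
      rintro _ ⟨x, rfl⟩
      exact ⟨_, fun j hj => Function.update_of_ne hj _ _, rfl⟩)
  let e (i : Fin n) : ℕ ↪ A i := (hA i).natEmbedding
  let p (k : ℕ) (i : Fin n) : Γ i := e i k
  have := hfin.to_subtype
  obtain ⟨c, hc⟩ := Finite.exists_infinite_fiber fun k : ℕ =>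
    (⟨σ (p k), p k, fun i _ => (e i k).2, rfl⟩ : σ '' Set.univ.pi A)
  let g := Infinite.natEmbedding ((fun k : ℕ =>
    (⟨σ (p k), p k, fun i _ => (e i k).2, rfl⟩ : σ '' Set.univ.pi A)) ⁻¹' {c})
  have hg (j : ℕ) : σ (p (g j)) = c := congrArg Subtype.val (g j).2
  refine ⟨fun j => p (g j), fun j k hjk i h => hjk ?_, fun j k => (hg j).trans (hg k).symm⟩
  exact g.injective (Subtype.ext ((e i).injective (Subtype.ext h)))
end

section
/- Let n ≥ 1 and let Γ_1, …, Γ_n be nonempty sets, Γ = Γ_1 × ⋯ × Γ_n, and let σ : Γ → C be a function such that (i) there is no infinite sequence of pairwise diagonal points of Γ on which σ is constant, and (ii) the image under σ of every line in Γ is finite. Then there exist a set C̃ and a function σ̃ : Γ → C̃ which also satisfies (i) and (ii) and which moreover has the property that for every c ∈ C̃ there exist a point a ∈ Γ and an index i such that σ̃^{-1}({c}) is contained in the hyperplane H(a, i) = {b ∈ Γ : b(i) = a(i)}. -/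
open Cardinal in
/-- A finite product of types of cardinality at most an infinite `μ` has cardinality at most `μ`. -/
theorem mk_pi_le_of_forall_mk_le {ι : Type} [Finite ι] {Z : ι → Type*} {μ : Cardinal}
    (hμ : ℵ₀ ≤ μ) (hZ : ∀ i, #(Z i) ≤ μ) : #(∀ i, Z i) ≤ μ := by
  have := Fintype.ofFinite ι
  rw [mk_pi]
  refine (prod_le_prod _ _ hZ).trans ?_
  rw [prod_const, mk_fintype]
  simpa using power_nat_le (n := Fintype.card ι) hμ

/-- If no infinite pairwise diagonal sequence has constant colour, and lines have finitely many
colours, then every point can be assigned a direction so that on each line only finitely many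
points are assigned the direction of that line. -/
theorem exists_direction {ι C : Type*} {Γ : ι → Type*} (σ : (∀ i, Γ i) → C)
    (h1 : ¬ ∃ a : ℕ → ∀ i, Γ i,
        (∀ j k, j ≠ k → ∀ i, a j i ≠ a k i) ∧ (∀ j k, σ (a j) = σ (a k)))
    (h2 : ∀ (a : ∀ i, Γ i) (i : ι), (σ '' {b | ∀ j, j ≠ i → b j = a j}).Finite) :
    ∃ p : (∀ i, Γ i) → ι, ∀ (a : ∀ i, Γ i) (i : ι),
      {b | (∀ j, j ≠ i → b j = a j) ∧ p b = i}.Finite := by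
  classical
  have hF : ∀ c, ∃ F : Finset (∀ i, Γ i), ∀ b, σ b = c → ∃ i, ∃ f ∈ F, f i = b i := by
    intro c
    by_contra! hc
    obtain ⟨a, ha, ha'⟩ := exists_seq_of_forall_finset_exists (fun b => σ b = c)
      (fun x y : ∀ i, Γ i => ∀ i, x i ≠ y i) fun s _ => by
        obtain ⟨b, hb, hb'⟩ := hc s
        exact ⟨b, hb, fun x hx i => hb' i x hx⟩
    refine h1 ⟨a, fun j k hjk i => ?_, fun j k => (ha j).trans (ha k).symm⟩
    rcases hjk.lt_or_gt with h | h
    · exact ha' j k h i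
    · exact (ha' k j h i).symm
  choose F hF using hF
  choose p f hf hfp using fun b => hF (σ b) b rfl
  refine ⟨p, fun a i => ?_⟩
  have hfin : (⋃ c ∈ σ '' {b | ∀ j, j ≠ i → b j = a j},
      (fun f : ∀ i, Γ i => Function.update a i (f i)) '' (F c : Set (∀ i, Γ i))).Finite :=
    (h2 a i).biUnion fun c _ => (F c).finite_toSet.image _
  refine hfin.subset ?_
  rintro b ⟨hb, rfl⟩
  refine Set.mem_biUnion (Set.mem_image_of_mem σ hb) ⟨f b, hf b, ?_⟩
  funext j
  by_cases hj : j = p b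
  · subst hj
    simpa using hfp b
  · simpa [hj] using (hb j hj).symm

open Cardinal Ordinal in
/-- Coordinates of size at least `ℵ_ ω` can be frozen so that no frozen direction is assigned to
any point whose other coordinates range over sets of bounded size below `ℵ_ ω`. -/
theorem exists_forall_direction_notMem {ι : Type} [Finite ι] {Γ : ι → Type*}
    [∀ i, Nonempty (Γ i)] (p : (∀ i, Γ i) → ι)
    (hp : ∀ (a : ∀ i, Γ i) (i : ι), {b | (∀ j, j ≠ i → b j = a j) ∧ p b = i}.Finite)
    (R : Finset ι) (hR : ∀ i ∈ R, ℵ_ ω ≤ #(Γ i)) {μ : Cardinal} (hμ : ℵ₀ ≤ μ) (hμ' : μ < ℵ_ ω)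
    (X : ∀ i, Set (Γ i)) (hX : ∀ i ∉ R, #(X i) ≤ μ) :
    ∃ y : ∀ i, Γ i, ∀ b : ∀ i, Γ i,
      (∀ i ∉ R, b i ∈ X i) → (∀ i ∈ R, b i = y i) → p b ∉ R := by
  classical
  induction R using Finset.induction_on generalizing μ X with
  | empty => exact ⟨fun i => Classical.arbitrary _, by simp⟩
  | insert r R hr ih =>
    have hsucc : Order.succ μ < ℵ_ ω := by
      obtain ⟨o, rfl⟩ := mem_range_aleph_iff.2 hμ
      rw [succ_aleph]
      exact aleph_lt_aleph.2 (isSuccLimit_omega0.add_one_lt (aleph_lt_aleph.1 hμ'))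
    obtain ⟨V, hV⟩ := le_mk_iff_exists_set.1 (hsucc.le.trans (hR r (by simp)))
    obtain ⟨y, hy⟩ := ih (fun i hi => hR i (by simp [hi])) (hμ.trans (Order.le_succ μ)) hsucc
      (Function.update X r V) fun i hi => by
        by_cases hir : i = r
        · subst hir
          simp [hV]
        · simpa [hir] using (hX i (by simp [hi, hir])).trans (Order.le_succ μ)
    let Z : ∀ i, Set (Γ i) := fun i => if i ∈ insert r R then {y i} else X i
    have hZ : ∀ i, #(Z i) ≤ μ := by
      intro i
      by_cases hi : i ∈ insert r R
      · simp only [Z, if_pos hi, mk_singleton]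
        exact one_le_aleph0.trans hμ
      · simp only [Z, if_neg hi]
        exact hX i hi
    let B : Set (Γ r) := ⋃ f : ∀ i, Z i,
      (fun b : ∀ i, Γ i => b r) '' {b | (∀ j, j ≠ r → b j = f j) ∧ p b = r}
    have hB : #B ≤ μ := by
      have hc : ∀ f : ∀ i, Z i, #((fun b : ∀ i, Γ i => b r) ''
          {b | (∀ j, j ≠ r → b j = f j) ∧ p b = r}) ≤ ℵ₀ := fun f =>
        ((hp (fun i => f i) r).image _).countable.le_aleph0
      calc #B ≤ _ := mk_iUnion_le_sum_mk
        _ ≤ _ := sum_le_sum _ _ hc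
        _ = #(∀ i, Z i) * ℵ₀ := by simp
        _ ≤ μ * μ := mul_le_mul' (mk_pi_le_of_forall_mk_le hμ hZ) hμ
        _ = μ := mul_eq_self hμ
    obtain ⟨v, hvV, hvB⟩ : ∃ v ∈ V, v ∉ B := by
      by_contra! h
      exact ((mk_le_mk_of_subset h).trans hB).not_gt (hV ▸ Order.lt_succ μ)
    refine ⟨Function.update y r v, fun b hbX hby => ?_⟩
    have hbr : b r = v := by simpa using hby r (by simp)
    have hbR : ∀ i ∈ R, b i = y i := fun i hi => by
      have hir : i ≠ r := fun h => hr (h ▸ hi)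
      simpa [hir] using hby i (by simp [hi])
    rw [Finset.mem_insert, not_or]
    constructor
    · intro hpb
      refine hvB (Set.mem_iUnion.2 ⟨fun i => ⟨if i = r then y i else b i, ?_⟩, b, ⟨?_, hpb⟩, hbr⟩)
      · by_cases hir : i = r
        · simp [Z, hir]
        · by_cases hi : i ∈ R
          · simp [Z, hir, hi, hbR i hi]
          · simpa [Z, hir, hi] using hbX i (by simp [hir, hi])
      · intro j hj
        simp [hj]
    · refine hy b (fun i hi => ?_) hbR
      by_cases hir : i = r
      · subst hir
        simpa [hbr] using hvV
      · simpa [hir] using hbX i (by simp [hi, hir])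

open Cardinal Ordinal in
theorem lemma_3_3 {n : ℕ} (hn : 1 ≤ n) {Γ : Fin n → Type*} [∀ i, Nonempty (Γ i)]
    {C : Type*} (σ : (∀ i, Γ i) → C)
    (h1 : ¬ ∃ a : ℕ → ∀ i, Γ i,
        (∀ j k, j ≠ k → ∀ i, a j i ≠ a k i) ∧ (∀ j k, σ (a j) = σ (a k)))
    (h2 : ∀ (a : ∀ i, Γ i) (i : Fin n),
        (σ '' {b | ∀ j, j ≠ i → b j = a j}).Finite) :
    ∃ (C' : Type) (σ' : (∀ i, Γ i) → C'),
      (¬ ∃ a : ℕ → ∀ i, Γ i,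
          (∀ j k, j ≠ k → ∀ i, a j i ≠ a k i) ∧ (∀ j k, σ' (a j) = σ' (a k))) ∧
      (∀ (a : ∀ i, Γ i) (i : Fin n),
          (σ' '' {b | ∀ j, j ≠ i → b j = a j}).Finite) ∧
      (∀ c : C', ∃ (a : ∀ i, Γ i) (i : Fin n),
          {b : ∀ i, Γ i | σ' b = c} ⊆ {b | b i = a i}) := by
  classical
  obtain ⟨p, hp⟩ := exists_direction σ h1 h2
  let R : Finset (Fin n) := {i | ℵ_ ω ≤ #(Γ i)}
  have hR : ∀ i, i ∈ R ↔ ℵ_ ω ≤ #(Γ i) := by simp [R]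
  have hω : ℵ₀ < ℵ_ ω := by
    rw [← aleph_zero]
    exact aleph_lt_aleph.2 omega0_pos
  have hμ : Rᶜ.sup (fun i => #(Γ i)) < ℵ_ ω :=
    (Finset.sup_lt_iff (bot_le.trans_lt hω)).2 fun i hi => by
      simpa [hR] using hi
  obtain ⟨y, hy⟩ := exists_forall_direction_notMem p hp R (fun i hi => (hR i).1 hi)
    le_sup_left (sup_lt_iff.2 ⟨hω, hμ⟩) (fun _ => Set.univ) fun i hi => by
      rw [mk_univ]
      exact (Finset.le_sup (f := fun i => #(Γ i)) (Finset.mem_compl.2 hi)).trans le_sup_right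
  let T : Type := (ℵ_ ω : Cardinal.{0}).out
  have he : ∀ i, ∃ e : Γ i → T, i ∉ R → Function.Injective e := by
    intro i
    by_cases hi : i ∈ R
    · have : Nonempty T := mk_ne_zero_iff.1 (by simpa [T] using (aleph_pos _).ne')
      exact ⟨fun _ => Classical.arbitrary T, fun h => absurd hi h⟩
    · have hle : lift.{0} #(Γ i) ≤ lift #T := by
        have := not_le.1 (mt (hR i).2 hi)
        simpa [T] using this.le
      obtain ⟨e⟩ := lift_mk_le'.1 hle
      exact ⟨e, fun _ => e.injective⟩
  choose e he using he
  let m : (∀ i, Γ i) → ∀ i, Γ i := fun b i => if i ∈ R then y i else b i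
  have hm : ∀ b, p (m b) ∉ R := fun b =>
    hy (m b) (fun _ _ => Set.mem_univ _) fun i hi => by simp [m, hi]
  let τ : (∀ i, Γ i) → Fin n × T := fun b => (p (m b), e _ (b (p (m b))))
  have hτ : ∀ b b', τ b = τ b' → b (p (m b')) = b' (p (m b')) := by
    intro b b' h
    obtain ⟨hq, hv⟩ := Prod.mk.inj h
    rw [hq] at hv
    exact he _ (hm b') hv
  refine ⟨Fin n × T, τ, ?_, fun a i => ?_, fun c => ?_⟩
  · rintro ⟨a, ha, hc⟩
    exact ha 0 1 zero_ne_one _ (hτ _ _ (hc 0 1))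
  · refine ((Set.finite_range fun j => (j, e j (a j))).union
      ((hp (m a) i).image fun b => (i, e i (b i)))).subset ?_
    rintro _ ⟨b, hb, rfl⟩
    by_cases hi : p (m b) = i
    · refine Or.inr ⟨m b, ⟨fun j hj => ?_, hi⟩, ?_⟩
      · simp [m, hb j hj]
      · have hiR : i ∉ R := hi ▸ hm b
        subst hi
        have hmb : m b (p (m b)) = b (p (m b)) := if_neg hiR
        simp only [τ, hmb]
    · exact Or.inl ⟨p (m b), by simp only [τ, hb _ hi]⟩
  · by_cases hc : ∃ b, τ b = c
    · obtain ⟨b₀, rfl⟩ := hc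
      exact ⟨b₀, p (m b₀), fun b hb => hτ b b₀ hb⟩
    · exact ⟨fun i => Classical.arbitrary _, ⟨0, hn⟩, fun b hb => absurd ⟨b, hb⟩ hc⟩
end

section
/- Let X be a real normed space and let D be a subset of the continuous dual X* which is dense in the weak* topology. Then the cardinality of X is at most 2^{|D|}. (Every x ∈ X is uniquely determined by its values on a weak*-dense subset of X*.) -/
open Cardinal

/-- A vector of a real normed space is determined by its values on a weak*-dense set. -/
theorem injective_eval_of_weakStarDense {X : Type*} [NormedAddCommGroup X]
    [NormedSpace ℝ X] {D : Set (WeakDual ℝ X)} (hD : Dense D) :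
    Function.Injective fun (x : X) (f : D) => (f : WeakDual ℝ X) x := by
  intro x y hxy
  have h : (fun f : WeakDual ℝ X => f x) = fun f => f y :=
    (WeakDual.eval_continuous x).ext_on hD (WeakDual.eval_continuous y)
      fun f hf => congrFun hxy ⟨f, hf⟩
  exact (SeparatingDual.eq_iff_forall_dual_eq (R := ℝ)).2 fun g => congrFun h (StrongDual.toWeakDual g)

/-- A real normed space whose dual has a finite weak*-dense subset is trivial. -/
theorem subsingleton_of_finite_weakStarDense {X : Type*} [NormedAddCommGroup X]
    [NormedSpace ℝ X] {D : Set (WeakDual ℝ X)} (hD : Dense D) (hfin : D.Finite) :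
    Subsingleton X := by
  have huniv : D = Set.univ := hfin.isClosed.closure_eq.symm.trans hD.closure_eq
  have hfinite : Finite (WeakDual ℝ X) := Set.finite_univ_iff.1 (huniv ▸ hfin)
  have hsub : Subsingleton (WeakDual ℝ X) := by
    by_contra hn
    have : Nontrivial (WeakDual ℝ X) := not_subsingleton_iff_nontrivial.1 hn
    have : Infinite (WeakDual ℝ X) := Module.Free.infinite ℝ (WeakDual ℝ X)
    exact not_finite (WeakDual ℝ X)
  refine ⟨fun x y => injective_eval_of_weakStarDense hD (funext fun f => ?_)⟩
  have hf : (f : WeakDual ℝ X) = 0 := Subsingleton.elim _ _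
  change (f : WeakDual ℝ X) x = (f : WeakDual ℝ X) y
  rw [hf]
  rfl

theorem card_le_two_pow_weakStarDense {X : Type*} [NormedAddCommGroup X]
    [NormedSpace ℝ X] (D : Set (WeakDual ℝ X)) (hD : Dense D) :
    #X ≤ 2 ^ #D := by
  rcases D.finite_or_infinite with hfin | hinf
  · have := subsingleton_of_finite_weakStarDense hD hfin
    exact (le_one_iff_subsingleton.2 this).trans (Cardinal.one_le_iff_pos.2 (power_pos _ two_pos))
  · have hD' : ℵ₀ ≤ #D := infinite_iff.1 hinf.to_subtype
    refine (mk_le_of_injective (injective_eval_of_weakStarDense hD)).trans ?_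
    simp only [mk_arrow, mk_real, lift_continuum, lift_uzero]
    rw [← two_power_aleph0, ← power_mul, aleph0_mul_eq hD']
end

section
/- Let X be a real normed space and let D be a dense subset of X. Then there exists a subset E of the continuous dual X*, dense in the weak* topology, with |E| ≤ max(|D|, ℵ₀). In particular the weak* density character of X* is at most the density character of X. -/
open Cardinal

/-- A set of functionals is weak* dense as soon as, within every ball of the dual, it meets every
nonempty set cut out by finitely many rational bounds on values at points of a dense set. -/
theorem dense_weakDual_of_rational_bounds {X : Type*} [NormedAddCommGroup X] [NormedSpace ℝ X]
    {D : Set X} (hD : Dense D) {E : Set (WeakDual ℝ X)}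
    (hE : ∀ (n : ℕ) (s : Finset (D × ℚ × ℚ)) (g : StrongDual ℝ X), ‖g‖ ≤ n →
      (∀ t ∈ s, (t.2.1 : ℝ) < g t.1 ∧ g t.1 < t.2.2) →
      ∃ f : StrongDual ℝ X, ‖f‖ ≤ n ∧ (∀ t ∈ s, (t.2.1 : ℝ) < f t.1 ∧ f t.1 < t.2.2) ∧
        StrongDual.toWeakDual f ∈ E) :
    Dense E := by
  classical
  intro g'
  obtain ⟨g, rfl⟩ := StrongDual.toWeakDual.surjective g'
  have hind : Topology.IsInducing (fun (f : WeakDual ℝ X) (x : X) => f x) := ⟨rfl⟩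
  have hbasis := (Filter.hasBasis_pi fun x : X => Metric.nhds_basis_ball (x := g x)).comap
    (fun (f : WeakDual ℝ X) (x : X) => f x)
  rw [← nhds_pi] at hbasis
  replace hbasis := (hind.nhds_eq_comap (StrongDual.toWeakDual g)) ▸ hbasis
  rw [mem_closure_iff_nhds_basis hbasis]
  rintro ⟨I, ε⟩ ⟨hI, hε⟩
  obtain ⟨n, hn⟩ := exists_nat_ge ‖g‖
  have approx (x : X) : ∃ t : D × ℚ × ℚ, ((t.2.1 : ℝ) < g t.1 ∧ g t.1 < t.2.2) ∧
      (x ∈ I → n * ‖x - t.1‖ ≤ ε x / 4 ∧ (t.2.2 : ℝ) - t.2.1 < ε x / 2) := by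
    obtain ⟨δ, hδ, hδε⟩ : ∃ δ : ℝ, 0 < δ ∧ (x ∈ I → δ = ε x) := by
      by_cases hx : x ∈ I
      · exact ⟨ε x, hε x hx, fun _ => rfl⟩
      · exact ⟨1, one_pos, fun h => absurd h hx⟩
    obtain ⟨d, hd, hxd⟩ := hD.exists_dist_lt x (ε := δ / 4 / (n + 1)) (by positivity)
    obtain ⟨a, ha, ha'⟩ := exists_rat_btwn (show g d - δ / 4 < g d by linarith)
    obtain ⟨b, hb, hb'⟩ := exists_rat_btwn (show g d < g d + δ / 4 by linarith)
    refine ⟨(⟨d, hd⟩, a, b), ⟨ha', hb⟩, fun hx => ?_⟩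
    rw [← hδε hx]
    rw [dist_eq_norm, lt_div_iff₀ (by positivity)] at hxd
    refine ⟨?_, by dsimp only; linarith⟩
    dsimp only
    nlinarith [norm_nonneg (x - d)]
  choose t ht htI using approx
  obtain ⟨f, hf, hft, hfE⟩ := hE n (hI.toFinset.image t) g hn (by
    simp only [Finset.mem_image]
    rintro _ ⟨x, -, rfl⟩
    exact ht x)
  refine ⟨_, hfE, fun x hx => ?_⟩
  have hfx := hft (t x) (Finset.mem_image_of_mem t (hI.mem_toFinset.2 hx))
  obtain ⟨hxd, hab⟩ := htI x hx
  have key (φ : StrongDual ℝ X) (hφ : ‖φ‖ ≤ n) : |φ x - φ (t x).1| ≤ ε x / 4 := by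
    rw [← map_sub, ← Real.norm_eq_abs]
    exact (φ.le_of_opNorm_le hφ _).trans hxd
  have h₁ := abs_le.1 (key f hf)
  have h₂ := abs_le.1 (key g hn)
  have h₃ := ht x
  change |f x - g x| < ε x
  rw [abs_lt]
  constructor <;> linarith [h₁.1, h₁.2, h₂.1, h₂.2, h₃.1, h₃.2, hfx.1, hfx.2]

theorem mk_nat_prod_finset_rat_bounds_le {X : Type*} (D : Set X) :
    #(ℕ × Finset (D × ℚ × ℚ)) ≤ max #D ℵ₀ := by
  have h₀ : ℵ₀ ≤ max #D ℵ₀ := le_max_right _ _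
  have h : #(D × ℚ × ℚ) ≤ max #D ℵ₀ := by
    rw [mk_prod, lift_uzero]
    refine mul_le_of_le h₀ ?_ ?_ <;> simp
  have hfin : #(Finset (D × ℚ × ℚ)) ≤ max #D ℵ₀ := by
    cases finite_or_infinite (D × ℚ × ℚ)
    · exact (mk_le_aleph0).trans h₀
    · rwa [mk_finset_of_infinite]
  rw [mk_prod]
  refine mul_le_of_le h₀ ?_ ?_
  · simp
  · simpa using hfin

theorem weakStar_dens_le_dens {X : Type*} [NormedAddCommGroup X]
    [NormedSpace ℝ X] (D : Set X) (hD : Dense D) :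
    ∃ E : Set (WeakDual ℝ X), Dense E ∧ #E ≤ max #D ℵ₀ := by
  classical
  let P (i : ℕ × Finset (D × ℚ × ℚ)) (f : StrongDual ℝ X) : Prop :=
    ‖f‖ ≤ i.1 ∧ ∀ t ∈ i.2, (t.2.1 : ℝ) < f t.1 ∧ f t.1 < t.2.2
  refine ⟨Set.range fun i => StrongDual.toWeakDual (Classical.epsilon (P i)),
    dense_weakDual_of_rational_bounds hD fun n s g hn hg => ?_,
    mk_range_le.trans (mk_nat_prod_finset_rat_bounds_le D)⟩
  have h : P (n, s) (Classical.epsilon (P (n, s))) := Classical.epsilon_spec ⟨g, hn, hg⟩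
  exact ⟨_, h.1, h.2, (n, s), rfl⟩
end
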